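/- arXiv:2002.09626 — 4 statements merged into one kernel-verified Lean document; each statement's English description precedes it below -/
import Mathlib

section
/- Exponential incremental input-output bound from discrete-time contraction: Consider the discrete-time system x_{k+1} = f(x_k, u_k), y_k = h(x_k, u_k) with f and h continuously differentiable, and let F_k(u_{[0,k]}; x_0) = h(φ_{k,0}(u, x_0), u_k) denote the output at time k from initial state x_0 under input sequence u. For some β > 0, assume the state dynamics is exponentially contracting in a positively invariant, convex, closed and bounded set X ⊆ ℝ^{n_x}, uniformly on U = [-β, β]^{n_u}, with a constant metric P > 0 and rate α ∈ (0,1), i.e., (∂f/∂x)^T P (∂f/∂x) ≤ α^2 P on X × U. Then there exist constants C_1, C_2 > 0 and α ∈ (0,1) such that ‖F_k(u_{[0,k]}; x_0) - F_k(ũ_{[0,k]}; x̃_0)‖ ≤ C_1 Σ_{m=0}^{k} α^{k-m} ‖u_m - ũ_m‖ + C_2 α^k ‖x_0 - x̃_0‖ for all k ≥ 0, all input sequences u, ũ with values satisfying sup_k max_j |u_{j,k}| < β, and all x_0, x̃_0 ∈ X. -/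
open Set RealInnerProductSpace

/-!
STATEMENT 4: Exponential incremental input-output bound from discrete-time contraction.
For `x_{k+1} = f(x_k,u_k)`, `y_k = h(x_k,u_k)` with `f, h` C¹, if the state dynamics is
exponentially contracting with a constant metric `P ≥ εI` and rate `α₀ ∈ (0,1)`
(`(∂f/∂x)ᵀ P (∂f/∂x) ≤ α₀² P`, phrased via quadratic forms of the Fréchet derivative)
in a positively invariant, convex, compact set `X`, uniformly on `U = [-β,β]^{n_u}`,
then there are `C₁, C₂ > 0` and `α ∈ (0,1)` such that any two output trajectories with
inputs bounded by `β` and initial states in `X` satisfy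
`‖y_k - ỹ_k‖ ≤ C₁ Σ_{m=0}^k α^{k-m} ‖u_m - ũ_m‖ + C₂ α^k ‖x_0 - x̃_0‖`.
-/

theorem cs_aux {E : Type*} [NormedAddCommGroup E] [InnerProductSpace ℝ E] (P : E →ₗ[ℝ] E)
    (hs : P.IsSymmetric) (hn : ∀ v, 0 ≤ ⟪P v, v⟫) (a b : E) :
    ⟪P a, b⟫ ≤ √⟪P a, a⟫ * √⟪P b, b⟫ := by
  have key : ∀ t : ℝ, 0 ≤ ⟪P a, a⟫ * (t * t) + (2 * ⟪P a, b⟫) * t + ⟪P b, b⟫ := by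
    intro t
    have := hn (t • a + b)
    have h2 : ⟪P b, a⟫ = ⟪P a, b⟫ := by rw [hs b a, real_inner_comm]
    simp only [map_add, map_smul, inner_add_left, inner_add_right, inner_smul_left,
      inner_smul_right, h2, RCLike.conj_to_real] at this
    linarith
  have hd := discrim_le_zero key
  unfold discrim at hd
  rw [← Real.sqrt_mul (hn a)]
  apply Real.le_sqrt_of_sq_le
  nlinarith

theorem tri_aux {E : Type*} [NormedAddCommGroup E] [InnerProductSpace ℝ E] (P : E →ₗ[ℝ] E)
    (hs : P.IsSymmetric) (hn : ∀ v, 0 ≤ ⟪P v, v⟫) (a b : E) :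
    √⟪P (a + b), a + b⟫ ≤ √⟪P a, a⟫ + √⟪P b, b⟫ := by
  rw [Real.sqrt_le_left (by positivity)]
  have h2 : ⟪P b, a⟫ = ⟪P a, b⟫ := by rw [hs b a, real_inner_comm]
  have := cs_aux P hs hn a b
  have e1 := Real.sq_sqrt (hn a)
  have e2 := Real.sq_sqrt (hn b)
  simp only [map_add, inner_add_left, inner_add_right, h2]
  nlinarith

theorem contr_aux {E : Type*} [NormedAddCommGroup E] [InnerProductSpace ℝ E] (P : E →ₗ[ℝ] E)
    (hs : P.IsSymmetric) (hn : ∀ v, 0 ≤ ⟪P v, v⟫) (g : E → E) (hg : Differentiable ℝ g)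
    (X : Set E) (hX : Convex ℝ X) (r : ℝ) (hr : 0 < r)
    (hc : ∀ x ∈ X, ∀ v, ⟪P (fderiv ℝ g x v), fderiv ℝ g x v⟫ ≤ r ^ 2 * ⟪P v, v⟫)
    (x y : E) (hx : x ∈ X) (hy : y ∈ X) :
    √⟪P (g x - g y), g x - g y⟫ ≤ r * √⟪P (x - y), x - y⟫ := by
  set w := g x - g y with hw
  have hl : ∀ t : ℝ, HasDerivAt (fun t : ℝ => y + t • (x - y)) (x - y) t := by
    intro t
    simpa using ((hasDerivAt_id t).smul_const (x - y)).const_add y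
  have hd : ∀ t : ℝ, HasDerivAt (fun t : ℝ => ⟪P w, g (y + t • (x - y))⟫)
      ⟪P w, fderiv ℝ g (y + t • (x - y)) (x - y)⟫ t := by
    intro t
    have h1 := (hg (y + t • (x - y))).hasFDerivAt.comp_hasDerivAt t (hl t)
    have h2 := (hasDerivAt_const t (P w)).inner ℝ h1
    simpa using h2
  obtain ⟨c, hc1, hc2⟩ := exists_hasDerivAt_eq_slope _ _ (zero_lt_one' ℝ)
    (fun t _ => (hd t).continuousAt.continuousWithinAt) (fun t _ => hd t)
  have hmem : y + c • (x - y) ∈ X := hX.add_smul_sub_mem hy hx ⟨hc1.1.le, hc1.2.le⟩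
  have hb := hc _ hmem (x - y)
  set z := fderiv ℝ g (y + c • (x - y)) (x - y)
  have e : ⟪P w, z⟫ = ⟪P w, w⟫ := by
    rw [hc2, hw]; simp [inner_sub_right]
  have h3 := cs_aux P hs hn w z
  have h4 : √⟪P z, z⟫ ≤ r * √⟪P (x - y), x - y⟫ := by
    rw [Real.sqrt_le_left (by positivity), mul_pow, Real.sq_sqrt (hn _)]
    exact hb
  rw [e] at h3
  have h5 := Real.mul_self_sqrt (hn w)
  rcases (Real.sqrt_nonneg ⟪P w, w⟫).eq_or_lt with h0 | h0
  · rw [← h0]; positivity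
  · have : √⟪P w, w⟫ ≤ √⟪P z, z⟫ := by
      rw [← h5] at h3
      simp only [Real.sqrt_mul_self h0.le] at h3
      exact le_of_mul_le_mul_left h3 h0
    exact this.trans h4

theorem box_compact (n : ℕ) (β : ℝ) :
    IsCompact {u : EuclideanSpace ℝ (Fin n) | ∀ j, u j ∈ Icc (-β) β} := by
  have h1 : IsCompact (Set.univ.pi (fun _ : Fin n => Icc (-β) β)) :=
    isCompact_univ_pi (fun _ => isCompact_Icc)
  have h2 := (EuclideanSpace.equiv (Fin n) ℝ).toHomeomorph.isCompact_preimage.2 h1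
  convert h2 using 1
  ext u
  exact ⟨fun h j _ => h j, fun h j => h j trivial⟩

theorem lip_aux {E F G : Type*} [NormedAddCommGroup E] [NormedSpace ℝ E]
    [NormedAddCommGroup F] [NormedSpace ℝ F] [NormedAddCommGroup G] [NormedSpace ℝ G]
    (g : E → F → G) (hg : ContDiff ℝ 1 (fun q : E × F => g q.1 q.2))
    (X : Set E) (U : Set F) (hX : IsCompact X) (hU : IsCompact U) :
    ∃ L : ℝ, 0 ≤ L ∧ ∀ x ∈ X, ∀ u ∈ U, ∀ y ∈ X, ∀ v ∈ U,
      ‖g x u - g y v‖ ≤ L * (‖x - y‖ + ‖u - v‖) := by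
  obtain ⟨K, hK⟩ := (hg.locallyLipschitz.locallyLipschitzOn
    (s := X ×ˢ U)).exists_lipschitzOnWith_of_compact (hX.prod hU)
  refine ⟨K, K.2, fun x hx u hu y hy v hv => ?_⟩
  have := hK.norm_sub_le (x := (x, u)) ⟨hx, hu⟩ (y := (y, v)) ⟨hy, hv⟩
  refine this.trans ?_
  gcongr
  rw [Prod.mk_sub_mk, Prod.norm_mk]
  exact max_le (by linarith [norm_nonneg (u - v)]) (by linarith [norm_nonneg (x - y)])

set_option maxHeartbeats 1000000 in
theorem discrete_contraction_incremental_io_bound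
    {nx nu ny : ℕ} (β : ℝ) (hβ : 0 < β)
    (f : EuclideanSpace ℝ (Fin nx) → EuclideanSpace ℝ (Fin nu) → EuclideanSpace ℝ (Fin nx))
    (h : EuclideanSpace ℝ (Fin nx) → EuclideanSpace ℝ (Fin nu) → EuclideanSpace ℝ (Fin ny))
    (hfC1 : ContDiff ℝ 1 (fun q : EuclideanSpace ℝ (Fin nx) × EuclideanSpace ℝ (Fin nu) => f q.1 q.2))
    (hhC1 : ContDiff ℝ 1 (fun q : EuclideanSpace ℝ (Fin nx) × EuclideanSpace ℝ (Fin nu) => h q.1 q.2))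
    (X : Set (EuclideanSpace ℝ (Fin nx)))
    (hXconv : Convex ℝ X) (hXcomp : IsCompact X) (hXne : X.Nonempty)
    -- positive invariance of X, uniformly on U = [-β,β]^{n_u}
    (hXinv : ∀ x ∈ X, ∀ u : EuclideanSpace ℝ (Fin nu), (∀ j, u j ∈ Icc (-β) β) → f x u ∈ X)
    -- exponential contraction with constant metric P ≥ εI and rate α₀ ∈ (0,1)
    (P : EuclideanSpace ℝ (Fin nx) →ₗ[ℝ] EuclideanSpace ℝ (Fin nx))
    (hPsymm : P.IsSymmetric) (ε : ℝ) (hε : 0 < ε)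
    (hPlow : ∀ v : EuclideanSpace ℝ (Fin nx), ε * ‖v‖ ^ 2 ≤ ⟪P v, v⟫)
    (α₀ : ℝ) (hα₀0 : 0 < α₀) (hα₀1 : α₀ < 1)
    (hcontr : ∀ x ∈ X, ∀ u : EuclideanSpace ℝ (Fin nu), (∀ j, u j ∈ Icc (-β) β) →
      ∀ v : EuclideanSpace ℝ (Fin nx),
        ⟪P ((fderiv ℝ (fun z => f z u) x) v), (fderiv ℝ (fun z => f z u) x) v⟫
          ≤ α₀ ^ 2 * ⟪P v, v⟫) :
    ∃ (C₁ C₂ α : ℝ), 0 < C₁ ∧ 0 < C₂ ∧ 0 < α ∧ α < 1 ∧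
      ∀ (u u' : ℕ → EuclideanSpace ℝ (Fin nu)),
        (∀ k j, |u k j| < β) → (∀ k j, |u' k j| < β) →
        ∀ (x x' : ℕ → EuclideanSpace ℝ (Fin nx)),
          x 0 ∈ X → x' 0 ∈ X →
          (∀ k, x (k + 1) = f (x k) (u k)) → (∀ k, x' (k + 1) = f (x' k) (u' k)) →
          ∀ k : ℕ,
            ‖h (x k) (u k) - h (x' k) (u' k)‖ ≤
              C₁ * ∑ m ∈ Finset.range (k + 1), α ^ (k - m) * ‖u m - u' m‖
                + C₂ * α ^ k * ‖x 0 - x' 0‖ := by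
  obtain ⟨Lf, hLf0, hLf⟩ := lip_aux f hfC1 X _ hXcomp (box_compact nu β)
  obtain ⟨Lh, hLh0, hLh⟩ := lip_aux h hhC1 X _ hXcomp (box_compact nu β)
  have hn : ∀ v, 0 ≤ ⟪P v, v⟫ := fun v => le_trans (by positivity) (hPlow v)
  obtain ⟨V, hV⟩ : ∃ V : EuclideanSpace ℝ (Fin nx) → ℝ, ∀ v, V v = √⟪P v, v⟫ := ⟨_, fun _ => rfl⟩
  obtain ⟨c, hc0, hc⟩ : ∃ c : ℝ, 0 ≤ c ∧ ∀ v, V v ≤ c * ‖v‖ := by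
    refine ⟨√‖LinearMap.toContinuousLinearMap P‖, by positivity, fun v => ?_⟩
    rw [hV, Real.sqrt_le_left (by positivity), mul_pow, Real.sq_sqrt (by positivity)]
    have h1 := real_inner_le_norm (P v) v
    have h2 := (LinearMap.toContinuousLinearMap P).le_opNorm v
    simp only [LinearMap.coe_toContinuousLinearMap'] at h2
    nlinarith [norm_nonneg v]
  obtain ⟨s, hs0, hs⟩ : ∃ s : ℝ, 0 ≤ s ∧ ∀ v, ‖v‖ ≤ s * V v := by
    refine ⟨(√ε)⁻¹, by positivity, fun v => ?_⟩
    have he : 0 < √ε := by positivity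
    rw [inv_mul_eq_div, le_div_iff₀ he, hV]
    apply Real.le_sqrt_of_sq_le
    rw [mul_pow, Real.sq_sqrt hε.le, mul_comm]
    exact hPlow v
  refine ⟨Lh * (s * (c * Lf / α₀) + 1) + 1, Lh * s * c + 1, α₀, by positivity, by positivity,
    hα₀0, hα₀1, ?_⟩
  intro u u' hu hu' x x' hx0 hx0' hx hx' k
  have hU : ∀ k j, u k j ∈ Icc (-β) β := fun k j => abs_le.1 (hu k j).le
  have hU' : ∀ k j, u' k j ∈ Icc (-β) β := fun k j => abs_le.1 (hu' k j).le
  have hxX : ∀ k, x k ∈ X := by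
    intro k
    induction k with
    | zero => exact hx0
    | succ k ih => rw [hx]; exact hXinv _ ih _ (hU k)
  have hxX' : ∀ k, x' k ∈ X := by
    intro k
    induction k with
    | zero => exact hx0'
    | succ k ih => rw [hx']; exact hXinv _ ih _ (hU' k)
  have step : ∀ k, V (x (k+1) - x' (k+1)) ≤ α₀ * V (x k - x' k) + c * Lf * ‖u k - u' k‖ := by
    intro k
    have hdiff : Differentiable ℝ (fun z => f z (u k)) :=
      (hfC1.differentiable (by norm_num)).comp
        (differentiable_id.prodMk (differentiable_const (u k)))
    have h1 := contr_aux P hPsymm hn (fun z => f z (u k)) hdiff X hXconv α₀ hα₀0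
      (fun z hz v => hcontr z hz (u k) (hU k) v) (x k) (x' k) (hxX k) (hxX' k)
    have h2 := tri_aux P hPsymm hn (f (x k) (u k) - f (x' k) (u k))
      (f (x' k) (u k) - f (x' k) (u' k))
    have h3 := hc (f (x' k) (u k) - f (x' k) (u' k))
    have h4 := hLf (x' k) (hxX' k) (u k) (hU k) (x' k) (hxX' k) (u' k) (hU' k)
    rw [sub_self, norm_zero, zero_add] at h4
    have h5 := mul_le_mul_of_nonneg_left h4 hc0
    rw [sub_add_sub_cancel] at h2
    simp only [← hV] at h1 h2
    rw [hx, hx']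
    linarith
  obtain ⟨S, hS⟩ : ∃ S : ℕ → ℝ, ∀ k, S k =
    ∑ m ∈ Finset.range (k + 1), α₀ ^ (k - m) * ‖u m - u' m‖ := ⟨_, fun _ => rfl⟩
  have hS0 : S 0 = ‖u 0 - u' 0‖ := by simp [hS]
  have hSs : ∀ k, S (k+1) = α₀ * S k + ‖u (k+1) - u' (k+1)‖ := by
    intro k
    rw [hS, hS, Finset.sum_range_succ, Finset.mul_sum]
    simp only [Nat.sub_self, pow_zero, one_mul]
    congr 1
    apply Finset.sum_congr rfl
    intro m hm
    have : k + 1 - m = (k - m) + 1 := by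
      have := Finset.mem_range.1 hm
      omega
    rw [this, pow_succ]; ring
  have hSn : ∀ k, 0 ≤ S k := by
    intro k
    rw [hS]
    exact Finset.sum_nonneg (fun m _ => mul_nonneg (pow_nonneg hα₀0.le _) (norm_nonneg _))
  have hSd : ∀ k, ‖u k - u' k‖ ≤ S k := by
    intro k
    cases k with
    | zero => rw [hS0]
    | succ k => rw [hSs]; nlinarith [hSn k]
  have main : ∀ k, α₀ * V (x k - x' k) ≤
      α₀ ^ (k+1) * V (x 0 - x' 0) + c * Lf * (S k - ‖u k - u' k‖) := by
    intro k
    induction k with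
    | zero => simp [hS0]
    | succ k ih =>
      rw [hSs, pow_succ]
      have i1 := mul_le_mul_of_nonneg_left (step k) hα₀0.le
      have i2 := mul_le_mul_of_nonneg_left ih hα₀0.le
      linarith
  have hVk : V (x k - x' k) ≤ α₀ ^ k * (c * ‖x 0 - x' 0‖) + c * Lf / α₀ * S k := by
    have h1 := main k
    have h2 : 0 ≤ c * Lf * ‖u k - u' k‖ :=
      mul_nonneg (mul_nonneg hc0 hLf0) (norm_nonneg _)
    have h3 := mul_le_mul_of_nonneg_left (hc (x 0 - x' 0)) (pow_nonneg hα₀0.le (k+1))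
    have h4 : α₀ * (α₀ ^ k * (c * ‖x 0 - x' 0‖) + c * Lf / α₀ * S k) =
      α₀ ^ (k+1) * (c * ‖x 0 - x' 0‖) + c * Lf * S k := by
      field_simp
      ring
    refine le_of_mul_le_mul_left ?_ hα₀0
    rw [h4]; linarith
  rw [← hS]
  have g1 := hLh (x k) (hxX k) (u k) (hU k) (x' k) (hxX' k) (u' k) (hU' k)
  have g2 := (hs (x k - x' k)).trans (mul_le_mul_of_nonneg_left hVk hs0)
  have g3 := mul_le_mul_of_nonneg_left (add_le_add g2 (hSd k)) hLh0
  have g4 : 0 ≤ α₀ ^ k * ‖x 0 - x' 0‖ :=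
    mul_nonneg (pow_nonneg hα₀0.le _) (norm_nonneg _)
  have g5 := hSn k
  refine (g1.trans g3).trans ?_
  nlinarith
end

section
/- Forward-Euler discretization preserves contraction: Consider the continuous-time dynamics ẋ = f(x(t), u(t)) + B_r r(t), where f is continuously differentiable and B_r is a constant matrix. Assume it is exponentially contracting in a set X, uniformly in (u, r) on ℝ^{n_u + n_r}, with a constant metric P > 0 and rate λ > 0 (i.e., (∂f/∂x)^T P + P (∂f/∂x) ≤ -2λP on X × ℝ^{n_u}), and assume ∂f/∂x is bounded on X × ℝ^{n_u}. Let f_d(x, u, d) = x + t_s (f(x, u) + B_d d), where t_s > 0 is a sampling period and B_d is a constant matrix. Then there exists a sufficiently small t_s > 0 such that the discrete-time dynamics x_{k+1} = f_d(x_k, u_k, d_k) is exponentially contracting in X, uniformly in (u, d) on ℝ^{n_u + n_d}; specifically, (∂f_d/∂x)^T P (∂f_d/∂x) ≤ α(t_s)^2 P on X × ℝ^{n_u} with α(t_s)^2 = 1 - 2 t_s λ + t_s^2 (λ_max[P]/λ_min[P]) σ̄^2 < 1, where σ̄ is a bound on σ_max[∂f/∂x]. -/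
open Set RealInnerProductSpace

/-!
STATEMENT 6: Forward-Euler discretization preserves contraction.
The continuous-time dynamics `ẋ = f(x,u) + B_r r` is exponentially contracting in `X`
uniformly in `(u,r)` on `ℝ^{n_u+n_r}` with constant metric `P > 0` and rate `λ > 0`
(`(∂f/∂x)ᵀ P + P (∂f/∂x) ≤ -2λP` on `X × ℝ^{n_u}`, phrased via quadratic forms of the
Fréchet derivative), and `∂f/∂x` is bounded by `σ̄` on `X × ℝ^{n_u}`.  Then for all
sufficiently small sampling periods `t_s > 0`, the forward-Euler map
`f_d(x,u,d) = x + t_s (f(x,u) + B_d d)` satisfies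
`(∂f_d/∂x)ᵀ P (∂f_d/∂x) ≤ α(t_s)² P` on `X`, uniformly in `(u,d)`, with
`α(t_s)² = 1 - 2 t_s λ + t_s² (λ_max[P]/λ_min[P]) σ̄² < 1`, where `λ_max[P]` and
`λ_min[P]` are encoded through the two-sided bounds `lamMin ‖h‖² ≤ ⟪P h, h⟫ ≤ lamMax ‖h‖²`.
-/

theorem forward_euler_preserves_contraction
    {nx nu nr nd : ℕ}
    (f : EuclideanSpace ℝ (Fin nx) → EuclideanSpace ℝ (Fin nu) → EuclideanSpace ℝ (Fin nx))
    (hf : ContDiff ℝ 1 (fun q : EuclideanSpace ℝ (Fin nx) × EuclideanSpace ℝ (Fin nu) => f q.1 q.2))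
    (Br : EuclideanSpace ℝ (Fin nr) →L[ℝ] EuclideanSpace ℝ (Fin nx))
    (Bd : EuclideanSpace ℝ (Fin nd) →L[ℝ] EuclideanSpace ℝ (Fin nx))
    (X : Set (EuclideanSpace ℝ (Fin nx)))
    -- constant metric P with λ_min[P] ≥ lamMin > 0 and λ_max[P] ≤ lamMax
    (P : EuclideanSpace ℝ (Fin nx) →ₗ[ℝ] EuclideanSpace ℝ (Fin nx))
    (hPsymm : P.IsSymmetric)
    (lamMin lamMax : ℝ) (hlamMin : 0 < lamMin)
    (hPlow : ∀ h : EuclideanSpace ℝ (Fin nx), lamMin * ‖h‖ ^ 2 ≤ ⟪P h, h⟫)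
    (hPhigh : ∀ h : EuclideanSpace ℝ (Fin nx), ⟪P h, h⟫ ≤ lamMax * ‖h‖ ^ 2)
    -- contraction of the continuous-time dynamics: (∂f/∂x)ᵀP + P(∂f/∂x) ≤ -2λP on X × ℝ^{n_u}
    (lam : ℝ) (hlam : 0 < lam)
    (hcontr : ∀ x ∈ X, ∀ u : EuclideanSpace ℝ (Fin nu),
      ∀ h : EuclideanSpace ℝ (Fin nx),
        ⟪P ((fderiv ℝ (fun z => f z u) x) h), h⟫ + ⟪P h, (fderiv ℝ (fun z => f z u) x) h⟫
          ≤ -(2 * lam) * ⟪P h, h⟫)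
    -- boundedness of the Jacobian: σ_max[∂f/∂x] ≤ σ̄ on X × ℝ^{n_u}
    (σbar : ℝ)
    (hσ : ∀ x ∈ X, ∀ u : EuclideanSpace ℝ (Fin nu), ‖fderiv ℝ (fun z => f z u) x‖ ≤ σbar) :
    ∃ t0 : ℝ, 0 < t0 ∧ ∀ ts : ℝ, 0 < ts → ts ≤ t0 →
      (1 - 2 * ts * lam + ts ^ 2 * (lamMax / lamMin) * σbar ^ 2 < 1) ∧
      ∀ x ∈ X, ∀ (u : EuclideanSpace ℝ (Fin nu)) (d : EuclideanSpace ℝ (Fin nd)),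
        ∀ h : EuclideanSpace ℝ (Fin nx),
          ⟪P ((fderiv ℝ (fun z => z + ts • (f z u + Bd d)) x) h),
              (fderiv ℝ (fun z => z + ts • (f z u + Bd d)) x) h⟫
            ≤ (1 - 2 * ts * lam + ts ^ 2 * (lamMax / lamMin) * σbar ^ 2) * ⟪P h, h⟫ := by
  set c : ℝ := lamMax / lamMin * σbar ^ 2 with hc
  refine ⟨lam / (|c| + 1), by positivity, ?_⟩
  intro ts hts hle
  have hpos : 0 < |c| + 1 := by positivity
  rw [le_div_iff₀ hpos] at hle
  constructor
  · have h1 : ts * c ≤ ts * |c| := mul_le_mul_of_nonneg_left (le_abs_self c) hts.le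
    have h2 : ts * c < 2 * lam := by nlinarith
    have h3 := mul_lt_mul_of_pos_left h2 hts
    have h4 : ts ^ 2 * (lamMax / lamMin) * σbar ^ 2 = ts * (ts * c) := by rw [hc]; ring
    rw [h4]; linarith
  · intro x hx u d h
    have hdiff : DifferentiableAt ℝ (fun z => f z u) x := by
      have h1 : Differentiable ℝ
          (fun q : EuclideanSpace ℝ (Fin nx) × EuclideanSpace ℝ (Fin nu) => f q.1 q.2) :=
        hf.differentiable (by norm_num)
      have h2 : DifferentiableAt ℝ (fun z : EuclideanSpace ℝ (Fin nx) => (z, u)) x := by fun_prop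
      exact (h1 (x, u)).comp x h2
    have hC := hcontr x hx u h
    have hS := hσ x hx u
    have hD : HasFDerivAt (fun z => z + ts • (f z u + Bd d))
        (ContinuousLinearMap.id ℝ (EuclideanSpace ℝ (Fin nx)) + ts • fderiv ℝ (fun z => f z u) x) x :=
      (hasFDerivAt_id x).add ((hdiff.hasFDerivAt.add_const (Bd d)).const_smul ts)
    rw [hD.fderiv]
    set A := fderiv ℝ (fun z => f z u) x with hA
    have hexp : ⟪P ((ContinuousLinearMap.id ℝ (EuclideanSpace ℝ (Fin nx)) + ts • A) h),
        (ContinuousLinearMap.id ℝ (EuclideanSpace ℝ (Fin nx)) + ts • A) h⟫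
        = ⟪P h, h⟫ + ts * (⟪P (A h), h⟫ + ⟪P h, A h⟫) + ts ^ 2 * ⟪P (A h), A h⟫ := by
      simp only [add_apply, smul_apply,
        ContinuousLinearMap.id_apply, map_add, map_smul, inner_add_left, inner_add_right,
        real_inner_smul_left, real_inner_smul_right]
      ring
    rw [hexp]
    have hkey : ⟪P (A h), A h⟫ ≤ c * ⟪P h, h⟫ := by
      by_cases h0 : h = 0
      · simp [h0]
      have hn : 0 < ‖h‖ ^ 2 := by positivity
      have hl := hPlow h
      have hM : 0 < lamMax := by
        have : 0 < lamMax * ‖h‖ ^ 2 :=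
          lt_of_lt_of_le (by positivity) (hl.trans (hPhigh h))
        exact pos_of_mul_pos_left this hn.le
      have hAh : ‖A h‖ ≤ σbar * ‖h‖ := A.le_of_opNorm_le hS h
      calc ⟪P (A h), A h⟫ ≤ lamMax * ‖A h‖ ^ 2 := hPhigh _
        _ ≤ lamMax * (σbar * ‖h‖) ^ 2 := by gcongr
        _ = c * (lamMin * ‖h‖ ^ 2) := by rw [hc]; field_simp
        _ ≤ c * ⟪P h, h⟫ := mul_le_mul_of_nonneg_left hl (by positivity)
    have h1 := mul_le_mul_of_nonneg_left hC hts.le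
    have h2 := mul_le_mul_of_nonneg_left hkey (sq_nonneg ts)
    have h4 : ts ^ 2 * (lamMax / lamMin) * σbar ^ 2 = ts ^ 2 * c := by rw [hc]; ring
    rw [h4]
    linarith
end

section
/- Quantitative step-size contraction inequality for Euler maps: Let P be a symmetric positive definite n×n real matrix and J an n×n real matrix such that J^T P + P J ≤ -2λP for some λ > 0 and σ_max[J] ≤ σ̄. Then for every t_s > 0, (I + t_s J)^T P (I + t_s J) ≤ (1 - 2 t_s λ + t_s^2 (λ_max[P]/λ_min[P]) σ̄^2) P. In particular, for sufficiently small t_s > 0 the factor 1 - 2 t_s λ + t_s^2 (λ_max[P]/λ_min[P]) σ̄^2 is strictly less than 1. -/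
open Matrix Finset

lemma aux_diag {n : Type*} [Fintype n] [DecidableEq n] (P : Matrix n n ℝ) (hP : P.IsHermitian)
    (a b : ℝ) (h : ∀ i, 0 ≤ a + b * hP.eigenvalues i) : (a • (1 : Matrix n n ℝ) + b • P).PosSemidef := by
  have hs := hP.spectral_theorem
  rw [Unitary.conjStarAlgAut_apply] at hs
  set U : Matrix n n ℝ := (hP.eigenvectorUnitary : Matrix n n ℝ) with hU
  have hUU : U * star U = 1 := Unitary.coe_mul_star_self hP.eigenvectorUnitary
  have hD : (diagonal (fun i => a + b * hP.eigenvalues i)).PosSemidef :=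
    PosSemidef.diagonal h
  have key := hD.mul_mul_conjTranspose_same U
  have e : diagonal (fun i => a + b * hP.eigenvalues i)
      = a • (1 : Matrix n n ℝ) + b • diagonal (RCLike.ofReal ∘ hP.eigenvalues) := by
    ext i j
    by_cases hij : i = j
    · subst hij; simp
    · simp [hij]
  rw [e, ← star_eq_conjTranspose, mul_add, add_mul, Matrix.mul_smul, Matrix.smul_mul, Matrix.mul_smul, Matrix.smul_mul, mul_one, hUU, ← hs] at key
  exact key

theorem euler_step_contraction_inequality
    {n : Type*} [Fintype n] [DecidableEq n] [Nonempty n]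
    (P J : Matrix n n ℝ) (hP : P.PosDef)
    (lam σbar : ℝ) (hlam : 0 < lam)
    (hcontr : ((-(2 * lam)) • P - (Jᵀ * P + P * J)).PosSemidef)
    (hσ : ∀ x : EuclideanSpace ℝ n, ‖Matrix.toEuclideanLin J x‖ ≤ σbar * ‖x‖)
    (lamMax lamMin : ℝ)
    (hmax : lamMax = Finset.univ.sup' Finset.univ_nonempty hP.1.eigenvalues)
    (hmin : lamMin = Finset.univ.inf' Finset.univ_nonempty hP.1.eigenvalues) :
    (∀ ts : ℝ, 0 < ts →
      ((1 - 2 * ts * lam + ts ^ 2 * (lamMax / lamMin) * σbar ^ 2) • P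
        - (1 + ts • J)ᵀ * P * (1 + ts • J)).PosSemidef)
    ∧ ∃ t0 : ℝ, 0 < t0 ∧ ∀ ts : ℝ, 0 < ts → ts < t0 →
        1 - 2 * ts * lam + ts ^ 2 * (lamMax / lamMin) * σbar ^ 2 < 1 := by
  have hMax : ∀ i, hP.1.eigenvalues i ≤ lamMax := fun i => by
    rw [hmax]; exact Finset.le_sup' _ (Finset.mem_univ i)
  have hMin : ∀ i, lamMin ≤ hP.1.eigenvalues i := fun i => by
    rw [hmin]; exact Finset.inf'_le _ (Finset.mem_univ i)
  have hminpos : 0 < lamMin := by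
    rw [hmin, Finset.lt_inf'_iff]
    intro i _
    exact hP.eigenvalues_pos i
  have hmaxpos : 0 < lamMax :=
    let i : n := Classical.arbitrary n
    hminpos.trans_le ((hMin i).trans (hMax i))
  constructor
  · intro ts hts
    have h1 := aux_diag P hP.1 (-lamMin) 1 (fun i => by linarith [hMin i])
    have h2 := (aux_diag P hP.1 lamMax (-1) (fun i => by linarith [hMax i])).conjTranspose_mul_mul_same J
    have h3 : (σbar ^ 2 • (1 : Matrix n n ℝ) - Jᵀ * J).PosSemidef := by
      refine PosSemidef.of_dotProduct_mulVec_nonneg ?_ ?_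
      · simp [IsHermitian, conjTranspose_eq_transpose_of_trivial]
      · intro x
        have hx := hσ (WithLp.toLp 2 x)
        have hx2 := pow_le_pow_left₀ (norm_nonneg _) hx 2
        rw [mul_pow, EuclideanSpace.real_norm_sq_eq, EuclideanSpace.real_norm_sq_eq] at hx2
        have e1 : star x ⬝ᵥ (σbar ^ 2 • (1 : Matrix n n ℝ) - Jᵀ * J) *ᵥ x
            = σbar ^ 2 * (x ⬝ᵥ x) - (J *ᵥ x) ⬝ᵥ (J *ᵥ x) := by
          rw [sub_mulVec, dotProduct_sub, smul_mulVec, one_mulVec, dotProduct_smul,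
            ← mulVec_mulVec, dotProduct_mulVec _ Jᵀ, vecMul_transpose]
          simp
        rw [e1]
        simp only [dotProduct, ← sq]
        simpa using hx2
    have h4 := ((hcontr.smul hts.le).add (h1.smul (show 0 ≤ ts^2 * (lamMax/lamMin) * σbar^2 by positivity))).add
      ((h3.smul (show 0 ≤ ts^2 * lamMax by positivity)).add (h2.smul (show 0 ≤ ts^2 by positivity)))
    convert h4 using 1
    have hc : ts^2 * (lamMax/lamMin) * σbar^2 * lamMin = ts^2 * lamMax * σbar^2 := by
      field_simp
    simp only [conjTranspose_eq_transpose_of_trivial, transpose_add, transpose_smul, transpose_one,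
      mul_add, add_mul, Matrix.mul_smul, Matrix.smul_mul, mul_one, one_mul, smul_add, smul_sub, smul_smul, mul_neg, hc]
    module
  · set k := lamMax / lamMin * σbar ^ 2 with hk
    have hk0 : 0 ≤ k := by positivity
    refine ⟨2 * lam / (k + 1), by positivity, fun ts h0 h => ?_⟩
    rw [lt_div_iff₀ (by positivity)] at h
    have : ts * (ts * (k+1)) < ts * (2 * lam) := mul_lt_mul_of_pos_left h h0
    have e : ts ^ 2 * (lamMax / lamMin) * σbar ^ 2 = ts ^ 2 * k := by rw [hk]; ring
    rw [e]
    nlinarith [sq_nonneg ts]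
end

section
/- Sufficient gain condition for negative definiteness of the closed-loop generalized Jacobian: Let c > 0, ḡ_0 > 0, λ_w > 0, and γ > 0, and let S be the symmetric (1+n)×(1+n) real matrix S = [[s, Q],[Q^T, S₂₂]], where s is a scalar with s ≤ -(ḡ_0 + γ)/c, Q ∈ ℝ^{1×n} is a row vector, and S₂₂ is a symmetric n×n matrix with S₂₂ ≤ -λ_w I. If γ > (c/λ_w) σ_max[Q]^2, then S is negative definite. -/
open Matrix

/-!
STATEMENT 11: Sufficient gain condition for negative definiteness of the closed-loop
generalized Jacobian.  For the symmetric block matrix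
`S = [[s, Q], [Qᵀ, S₂₂]]` with `s ≤ -(ḡ₀ + γ)/c` and `S₂₂ ≤ -λ_w I`,
the gain condition `γ > (c/λ_w) σ_max[Q]²` implies that `S` is negative definite.
For the row vector `Q`, `σ_max[Q]²` equals the squared Euclidean norm `Σ_j (Q 0 j)²`.
-/

theorem gain_condition_negative_definite
    {n : ℕ} (c g0 lamW γ : ℝ)
    (hc : 0 < c) (hg0 : 0 < g0) (hlamW : 0 < lamW) (hγ : 0 < γ)
    (s : ℝ) (Q : Matrix (Fin 1) (Fin n) ℝ) (S22 : Matrix (Fin n) (Fin n) ℝ)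
    (hS22symm : S22.IsHermitian)
    (hs : s ≤ -(g0 + γ) / c)
    (hS22 : ((-lamW) • (1 : Matrix (Fin n) (Fin n) ℝ) - S22).PosSemidef)
    (hgain : γ > (c / lamW) * ∑ j, (Q 0 j) ^ 2) :
    (-(Matrix.fromBlocks (Matrix.of fun _ _ => s) Q Qᵀ S22)).PosDef := by
  refine Matrix.PosDef.of_dotProduct_mulVec_pos ?_ ?_
  · refine Matrix.IsHermitian.neg ?_
    refine Matrix.IsHermitian.fromBlocks ?_ ?_ hS22symm
    · ext i j
      simp
    · ext i j
      simp
  intro x hx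
  obtain ⟨a, ha⟩ : ∃ a, a = x (Sum.inl 0) := ⟨_, rfl⟩
  obtain ⟨w, hw⟩ : ∃ w : Fin n → ℝ, w = fun j => x (Sum.inr j) := ⟨_, rfl⟩
  have hpsd := hS22.dotProduct_mulVec_nonneg w
  have h1 : star w ⬝ᵥ (((-lamW) • (1 : Matrix (Fin n) (Fin n) ℝ) - S22) *ᵥ w)
      = -lamW * (∑ j, w j ^ 2) - w ⬝ᵥ (S22 *ᵥ w) := by
    rw [Matrix.sub_mulVec, Matrix.smul_mulVec, Matrix.one_mulVec, star_trivial,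
      dotProduct_sub, dotProduct_smul]
    simp [dotProduct, sq]
  have hform : star x ⬝ᵥ (-(Matrix.fromBlocks (Matrix.of fun _ _ => s) Q Qᵀ S22) *ᵥ x)
      = -(s * a ^ 2 + 2 * a * (∑ j, Q 0 j * w j) + w ⬝ᵥ (S22 *ᵥ w)) := by
    rw [Matrix.neg_mulVec, dotProduct_neg, star_trivial]
    congr 1
    simp only [dotProduct, Matrix.mulVec, Fintype.sum_sum_type, Matrix.fromBlocks_apply₁₁,
      Matrix.fromBlocks_apply₁₂, Matrix.fromBlocks_apply₂₁, Matrix.fromBlocks_apply₂₂,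
      Finset.univ_unique, Finset.sum_singleton, Fin.default_eq_zero, Matrix.of_apply,
      Matrix.transpose_apply, ← ha, hw, mul_add, Finset.sum_add_distrib]
    have e : ∑ j, x (Sum.inr j) * (Q 0 j * a) = a * ∑ j, Q 0 j * x (Sum.inr j) := by
      rw [Finset.mul_sum]
      exact Finset.sum_congr rfl fun j _ => by ring
    rw [e]
    ring
  rw [h1] at hpsd
  rw [hform]
  have hsq : 0 ≤ lamW ^ 2 * (∑ j, w j ^ 2) - 2 * a * lamW * (∑ j, Q 0 j * w j)
      + a ^ 2 * ∑ j, Q 0 j ^ 2 := by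
    have : 0 ≤ ∑ j, (lamW * w j - a * Q 0 j) ^ 2 := Finset.sum_nonneg fun j _ => sq_nonneg _
    convert this using 1
    simp only [Finset.mul_sum, ← Finset.sum_sub_distrib, ← Finset.sum_add_distrib]
    exact Finset.sum_congr rfl fun j _ => by ring
  have hK : (∑ j, Q 0 j ^ 2) < -s * lamW := by
    have h2 : s * c ≤ -(g0 + γ) := (le_div_iff₀ hc).1 hs
    have h3 : c * (∑ j, Q 0 j ^ 2) < γ * lamW := by
      rw [gt_iff_lt, div_mul_eq_mul_div, div_lt_iff₀ hlamW] at hgain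
      exact hgain
    have h4 : γ * lamW ≤ (-s * c) * lamW :=
      mul_le_mul_of_nonneg_right (by linarith) hlamW.le
    refine lt_of_mul_lt_mul_left (a := c) ?_ hc.le
    linarith
  by_cases h0 : a = 0
  · have hwne : ∃ j, w j ≠ 0 := by
      by_contra! hcon
      apply hx
      ext i
      rcases i with i | j
      · rw [Subsingleton.elim i 0, ← ha, h0]
        rfl
      · simpa [hw] using hcon j
    obtain ⟨j, hj⟩ := hwne
    have hW : 0 < ∑ j, w j ^ 2 :=
      Finset.sum_pos' (fun _ _ => sq_nonneg _) ⟨j, Finset.mem_univ _, by positivity⟩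
    have := mul_pos hlamW hW
    rw [h0]
    linarith
  · have ha2 : 0 < a ^ 2 := by positivity
    have h5 := mul_lt_mul_of_pos_left hK ha2
    have h6 := mul_nonneg hlamW.le hpsd
    refine pos_of_mul_pos_right (a := lamW) ?_ hlamW.le
    linarith
end
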